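/- Let F be the free group on countably many generators (FreeGroup ℕ) and let H be a subgroup of the automorphism group Aut(F). If the index of H in Aut(F) is strictly less than 2^ℵ₀, then there exists a finite set A ⊆ F such that the pointwise stabilizer of A is contained in H. -/

import Mathlib

namespace SIP

/-- The free group of countably infinite rank. -/
abbrev F := FreeGroup ℕ

section Schreier
variable (E : Subgroup F)

/-- The coset of the identity. -/
def q0 : F ⧸ E := ((1 : F) : F ⧸ E)

/-- single letters -/
def ltr (s : ℕ × Bool) : F := FreeGroup.mk [s]

theorem ltr_true (a : ℕ) : ltr (a, true) = FreeGroup.of a := rfl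

theorem ltr_false (a : ℕ) : ltr (a, false) = (FreeGroup.of a)⁻¹ := rfl

theorem smul_q0 (g : F) : g • q0 E = (g : F ⧸ E) := by
  rw [q0]
  change ((g * 1 : F) : F ⧸ E) = _
  rw [mul_one]

theorem exists_parent : ∃ (l : F ⧸ E → ℕ) (p : F ⧸ E → ℕ × Bool),
    ∀ q, q ≠ q0 E → l ((ltr (p q))⁻¹ • q) < l q := by
  classical
  have hex : ∀ q : F ⧸ E, ∃ n : ℕ, ∃ L : List (ℕ × Bool),
      L.length = n ∧ FreeGroup.mk L • q0 E = q := by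
    intro q
    obtain ⟨g, rfl⟩ := QuotientGroup.mk_surjective q
    refine ⟨_, g.toWord, rfl, ?_⟩
    rw [FreeGroup.mk_toWord, smul_q0]
  have key : ∀ q : F ⧸ E, ∃ s : ℕ × Bool, q ≠ q0 E →
      Nat.find (hex ((ltr s)⁻¹ • q)) < Nat.find (hex q) := by
    intro q
    by_cases hq : q = q0 E
    · exact ⟨(0, true), fun h => absurd hq h⟩
    obtain ⟨L, hL, hLq⟩ := Nat.find_spec (hex q)
    cases L with
    | nil =>
      exfalso; apply hq; rw [← hLq]
      exact (one_smul _ _)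
    | cons s L' =>
      refine ⟨s, fun _ => ?_⟩
      have : (ltr s)⁻¹ • q = FreeGroup.mk L' • q0 E := by
        rw [inv_smul_eq_iff, ← hLq, ← mul_smul]
        rfl
      rw [← hL]
      refine lt_of_le_of_lt (Nat.find_min' _ ⟨L', rfl, this.symm⟩) ?_
      simp
  choose s hs using key
  exact ⟨fun q => Nat.find (hex q), s, hs⟩

open Classical in
/-- Schreier transversal. -/
noncomputable def tau (E : Subgroup F) (l : F ⧸ E → ℕ) (p : F ⧸ E → ℕ × Bool)
    (hp : ∀ q, q ≠ q0 E → l ((ltr (p q))⁻¹ • q) < l q) (q : F ⧸ E) : F :=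
  if h : q = q0 E then 1 else ltr (p q) * tau E l p hp ((ltr (p q))⁻¹ • q)
termination_by l q
decreasing_by exact hp q h

variable (l : F ⧸ E → ℕ) (p : F ⧸ E → ℕ × Bool)
    (hp : ∀ q, q ≠ q0 E → l ((ltr (p q))⁻¹ • q) < l q)

theorem tau_q0 : tau E l p hp (q0 E) = 1 := by
  rw [tau]; simp

theorem tau_ne {q : F ⧸ E} (h : q ≠ q0 E) :
    tau E l p hp q = ltr (p q) * tau E l p hp ((ltr (p q))⁻¹ • q) := by
  rw [tau]; simp [h]

theorem tau_smul (q : F ⧸ E) : tau E l p hp q • q0 E = q := by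
  induction hn : l q using Nat.strong_induction_on generalizing q with
  | _ n ih =>
    by_cases h : q = q0 E
    · rw [h, tau_q0, one_smul]
    · rw [tau_ne E l p hp h, mul_smul, ih _ (hn ▸ hp q h) _ rfl, smul_inv_smul]

/-- Tree edges of the Schreier graph. -/
def IsTree (e : (F ⧸ E) × ℕ) : Prop :=
  (FreeGroup.of e.2 • e.1 ≠ q0 E ∧ p (FreeGroup.of e.2 • e.1) = (e.2, true)) ∨
  (e.1 ≠ q0 E ∧ p e.1 = (e.2, false))

theorem tau_tree {q : F ⧸ E} {a : ℕ} (h : IsTree E p (q, a)) :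
    tau E l p hp (FreeGroup.of a • q) = FreeGroup.of a * tau E l p hp q := by
  rcases h with ⟨h1, h2⟩ | ⟨h1, h2⟩
  · dsimp only at h1 h2
    rw [tau_ne E l p hp h1, h2, ltr_true, inv_smul_smul]
  · dsimp only at h1 h2
    have := tau_ne E l p hp h1
    rw [h2, ltr_false, inv_inv] at this
    rw [this, mul_inv_cancel_left]

/-- index type of the Schreier basis -/
abbrev Idx := {e : (F ⧸ E) × ℕ // ¬ IsTree E p e}

/-- Schreier generator -/
noncomputable def gen (e : Idx E p) : E :=
  ⟨(tau E l p hp (FreeGroup.of e.1.2 • e.1.1))⁻¹ * (FreeGroup.of e.1.2 * tau E l p hp e.1.1), by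
    rw [← QuotientGroup.eq, ← smul_q0, ← smul_q0, tau_smul, mul_smul, tau_smul]⟩

open Classical in
/-- labels -/
noncomputable def lam (q : F ⧸ E) (a : ℕ) : FreeGroup (Idx E p) :=
  if h : IsTree E p (q, a) then 1 else FreeGroup.of ⟨(q, a), h⟩

theorem lift_lam (q : F ⧸ E) (a : ℕ) :
    ((FreeGroup.lift (gen E l p hp) (lam E p q a) : E) : F) =
      (tau E l p hp (FreeGroup.of a • q))⁻¹ * (FreeGroup.of a * tau E l p hp q) := by
  unfold lam
  split_ifs with h
  · rw [tau_tree E l p hp h]; simp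
  · simp [gen]

/-- permutation representation -/
noncomputable def sig (a : ℕ) : Equiv.Perm ((F ⧸ E) × FreeGroup (Idx E p)) where
  toFun z := (FreeGroup.of a • z.1, lam E p z.1 a * z.2)
  invFun z := ((FreeGroup.of a)⁻¹ • z.1, (lam E p ((FreeGroup.of a)⁻¹ • z.1) a)⁻¹ * z.2)
  left_inv z := by simp
  right_inv z := by simp

/-- permutation representation of the free group -/
noncomputable def Sig : F →* Equiv.Perm ((F ⧸ E) × FreeGroup (Idx E p)) :=
  FreeGroup.lift (sig E p)

theorem Sig_inv {X : Type} (J : (F ⧸ E) × FreeGroup (Idx E p) → X) (ρ : F →* Equiv.Perm X)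
    (h : ∀ a z, J (sig E p a z) = ρ (FreeGroup.of a) (J z)) (g : F) :
    ∀ z, J (Sig E p g z) = ρ g (J z) := by
  induction g using FreeGroup.induction_on with
  | C1 => simp
  | of a => intro z; simpa [Sig] using h a z
  | inv_of a ih =>
    intro z
    rw [map_inv, map_inv, eq_comm, Equiv.Perm.inv_eq_iff_eq, ← ih]
    simp
  | mul x y hx hy =>
    intro z
    rw [map_mul, map_mul, Equiv.Perm.mul_apply, hx, hy, Equiv.Perm.mul_apply]

theorem Sig_fst (g : F) (z) : (Sig E p g z).1 = g • z.1 :=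
  Sig_inv E p Prod.fst (MulAction.toPermHom F (F ⧸ E)) (fun _ _ => rfl) g z

theorem Sig_equiv (g : F) (z) (w : FreeGroup (Idx E p)) :
    Sig E p g (z.1, z.2 * w) = ((Sig E p g z).1, (Sig E p g z).2 * w) := by
  refine (Sig_inv E p (fun z => (z.1, z.2 * w)) (Sig E p) ?_ g z).symm
  intro a z
  simp [Sig, sig, mul_assoc]

theorem Sig_tau (q : F ⧸ E) : Sig E p (tau E l p hp q) (q0 E, 1) = (q, 1) := by
  induction hn : l q using Nat.strong_induction_on generalizing q with
  | _ n ih =>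
    by_cases h : q = q0 E
    · rw [h, tau_q0]; simp
    · rw [tau_ne E l p hp h, map_mul, Equiv.Perm.mul_apply, ih _ (hn ▸ hp q h) _ rfl]
      rcases hpq : p q with ⟨a, b⟩
      cases b with
      | false =>
        rw [ltr_false, map_inv, Equiv.Perm.inv_eq_iff_eq]
        have : IsTree E p (q, a) := Or.inr ⟨h, hpq⟩
        simp [Sig, sig, lam, this]
      | true =>
        rw [ltr_true]
        have : IsTree E p ((FreeGroup.of a)⁻¹ • q, a) := Or.inl (by simpa using ⟨h, hpq⟩)
        simp [Sig, sig, lam, this]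

/-- inverse hom -/
noncomputable def psi : E →* FreeGroup (Idx E p) where
  toFun e := (Sig E p e (q0 E, 1)).2
  map_one' := by simp
  map_mul' x y := by
    have h1 : Sig E p y (q0 E, 1) = (q0 E, 1 * (Sig E p y (q0 E, 1)).2) := by
      ext
      · rw [Sig_fst]
        change (y : F) • q0 E = _
        rw [smul_q0, q0, eq_comm, QuotientGroup.eq]; simp
      · simp
    rw [Subgroup.coe_mul, map_mul, Equiv.Perm.mul_apply, h1]
    have := Sig_equiv E p x (q0 E, 1) (Sig E p y (q0 E, 1)).2
    dsimp only at this
    rw [this]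
    simp

theorem psi_gen (e : Idx E p) : psi E p (gen E l p hp e) = FreeGroup.of e := by
  obtain ⟨⟨q, a⟩, he⟩ := e
  change (Sig E p ((tau E l p hp (FreeGroup.of a • q))⁻¹ *
    (FreeGroup.of a * tau E l p hp q)) (q0 E, 1)).2 = _
  rw [map_mul, map_mul, Equiv.Perm.mul_apply, Equiv.Perm.mul_apply, Sig_tau]
  have : Sig E p (tau E l p hp (FreeGroup.of a • q))⁻¹
      (Sig E p (FreeGroup.of a) (q, 1)) = (q0 E, FreeGroup.of ⟨(q, a), he⟩) := by
    rw [map_inv, Equiv.Perm.inv_eq_iff_eq]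
    have := Sig_equiv E p (tau E l p hp (FreeGroup.of a • q)) (q0 E, 1)
      (FreeGroup.of ⟨(q, a), he⟩)
    dsimp only at this
    rw [one_mul] at this
    rw [this, Sig_tau]
    simp [Sig, sig, lam, he]
  rw [this]

theorem lift_psi (e : E) : FreeGroup.lift (gen E l p hp) (psi E p e) = e := by
  have h := Sig_inv E p (fun z => tau E l p hp z.1 * (FreeGroup.lift (gen E l p hp) z.2 : E))
    (MulAction.toPermHom F F) (by
      intro a z
      simp only [sig, Equiv.coe_fn_mk, map_mul, Subgroup.coe_mul, lift_lam]
      simp [mul_assoc]) e (q0 E, 1)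
  simp only [tau_q0, map_one, Sig_fst] at h
  have h2 : (e : F) • q0 E = q0 E := by
    rw [smul_q0, q0, eq_comm, QuotientGroup.eq]; simp
  rw [h2, tau_q0] at h
  apply Subtype.ext
  simpa [psi] using h

/-- A subgroup of the free group has a basis that contains all the standard generators
lying in the subgroup. -/
theorem exists_basis : ∃ (ι : Type) (b : FreeGroupBasis ι E),
    ∀ a, FreeGroup.of a ∈ E → ∃ j, (b j : F) = FreeGroup.of a := by
  obtain ⟨l, p, hp⟩ := exists_parent E
  refine ⟨Idx E p, ⟨MonoidHom.toMulEquiv (psi E p) (FreeGroup.lift (gen E l p hp)) ?_ ?_⟩, ?_⟩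
  · ext e; simp [lift_psi]
  · ext e; simp [psi_gen]
  · intro a ha
    have h2 : FreeGroup.of a • q0 E = q0 E := by
      rw [smul_q0, q0, eq_comm, QuotientGroup.eq]; simpa
    refine ⟨⟨(q0 E, a), ?_⟩, ?_⟩
    · rintro (⟨h, -⟩ | ⟨h, -⟩)
      · exact h h2
      · exact h rfl
    · change ((FreeGroup.lift (gen E l p hp) (FreeGroup.of _) : E) : F) = _
      simp [gen, h2, tau_q0]

end Schreier
end SIP


namespace SIP

abbrev G := MulAut F

/-- The subgroup generated by the first `d` generators. -/
def Fd (d : ℕ) : Subgroup F := Subgroup.closure {w | ∃ i < d, w = FreeGroup.of i}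

lemma of_mem_Fd {i d : ℕ} (h : i < d) : (FreeGroup.of i : F) ∈ Fd d :=
  Subgroup.subset_closure ⟨i, h, rfl⟩

lemma Fd_mono {c d : ℕ} (h : c ≤ d) : Fd c ≤ Fd d := by
  apply Subgroup.closure_mono
  rintro w ⟨i, hi, rfl⟩
  exact ⟨i, by omega, rfl⟩

lemma Fd_le {d : ℕ} {K : Subgroup F} (h : ∀ i < d, FreeGroup.of i ∈ K) : Fd d ≤ K := by
  apply (Subgroup.closure_le _).2
  rintro w ⟨i, hi, rfl⟩
  exact h i hi

lemma eqOn_Fd {M : Type*} [Group M] {d : ℕ} {f g : F →* M}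
    (h : ∀ i < d, f (FreeGroup.of i) = g (FreeGroup.of i)) {w : F} (hw : w ∈ Fd d) :
    f w = g w := by
  have : Fd d ≤ f.eqLocus g := Fd_le h
  exact this hw

lemma exists_mem_Fd (w : F) : ∃ d, w ∈ Fd d := by
  induction w using FreeGroup.induction_on with
  | C1 => exact ⟨0, one_mem _⟩
  | of i => exact ⟨i+1, of_mem_Fd (by omega)⟩
  | inv_of i h => exact ⟨i+1, inv_mem (of_mem_Fd (by omega))⟩
  | mul x y hx hy =>
    obtain ⟨a, ha⟩ := hx
    obtain ⟨b, hb⟩ := hy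
    exact ⟨max a b, mul_mem (Fd_mono (le_max_left _ _) ha) (Fd_mono (le_max_right _ _) hb)⟩

lemma exists_finite_subset_Fd {A : Set F} (hA : A.Finite) : ∃ d, A ⊆ Fd d := by
  induction A, hA using Set.Finite.induction_on with
  | empty => exact ⟨0, by simp⟩
  | @insert a s _ _ ih =>
    obtain ⟨d, hd⟩ := ih
    obtain ⟨e, he⟩ := exists_mem_Fd a
    refine ⟨max d e, ?_⟩
    rintro w (rfl | hw)
    · exact Fd_mono (le_max_right _ _) he
    · exact Fd_mono (le_max_left _ _) (hd hw)

/-- automorphism from images of generators and a candidate inverse -/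
def mkAut (u v : ℕ → F) (h1 : ∀ i, FreeGroup.lift u (v i) = FreeGroup.of i)
    (h2 : ∀ i, FreeGroup.lift v (u i) = FreeGroup.of i) : G :=
  MonoidHom.toMulEquiv (FreeGroup.lift u) (FreeGroup.lift v)
    (by ext i; simp [h2]) (by ext i; simp [h1])

lemma mkAut_of (u v h1 h2) (i : ℕ) : mkAut u v h1 h2 (FreeGroup.of i) = u i := by
  simp [mkAut]

/-- `g` preserves the subgroup `C` setwise -/
def Pres (g : G) (C : Subgroup F) : Prop := ∀ w, g w ∈ C ↔ w ∈ C

open Classical in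
noncomputable def extFun {d : ℕ} (φ : Fd d ≃* Fd d) (i : ℕ) : F :=
  if h : i < d then (φ ⟨FreeGroup.of i, of_mem_Fd h⟩ : F) else FreeGroup.of i

lemma lift_extFun {d : ℕ} (φ : Fd d ≃* Fd d) (w : Fd d) :
    FreeGroup.lift (extFun φ) (w : F) = φ w := by
  obtain ⟨w, hw⟩ := w
  unfold Fd at hw
  induction hw using Subgroup.closure_induction with
  | mem x hx => 
    obtain ⟨i, hi, rfl⟩ := hx
    simp [extFun, hi]
  | one => 
    have : (⟨1, one_mem _⟩ : Fd d) = 1 := rfl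
    simp [this]
  | mul x y hx hy h1 h2 =>
    have : (⟨x * y, mul_mem hx hy⟩ : Fd d) = ⟨x, hx⟩ * ⟨y, hy⟩ := rfl
    simp only [map_mul] at *
    rw [this, h1, h2, map_mul]; rfl
  | inv x hx h =>
    have : (⟨x⁻¹, inv_mem hx⟩ : Fd d) = ⟨x, hx⟩⁻¹ := rfl
    simp only [map_inv] at *
    rw [this, h, map_inv]; rfl

lemma exists_ext {d : ℕ} (φ : Fd d ≃* Fd d) : ∃ g : G, ∀ w : Fd d, g w = φ w := by
  have key : ∀ (φ : Fd d ≃* Fd d) i, FreeGroup.lift (extFun φ) (extFun φ.symm i) = FreeGroup.of i := by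
    intro φ i
    by_cases h : i < d
    · have : extFun φ.symm i = (φ.symm ⟨FreeGroup.of i, of_mem_Fd h⟩ : F) := by simp [extFun, h]
      rw [this, lift_extFun]; simp
    · simp [extFun, h]
  refine ⟨mkAut (extFun φ) (extFun φ.symm) (key φ) (key φ.symm), fun w => ?_⟩
  exact lift_extFun φ w

/-- standard basis -/
lemma exists_std_basis (d : ℕ) : ∃ b : FreeGroupBasis (Fin d) (Fd d),
    ∀ i, (b i : F) = FreeGroup.of (i : ℕ) := by
  have hinj : Function.Injective (FreeGroup.map (Fin.val : Fin d → ℕ)) :=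
    FreeGroup.map_injective Fin.val_injective
  have hr : (FreeGroup.map (Fin.val : Fin d → ℕ)).range = Fd d := by
    rw [FreeGroup.map_eq_lift, FreeGroup.range_lift_eq_closure]
    unfold Fd
    congr 1
    ext w
    constructor
    · rintro ⟨i, rfl⟩; exact ⟨i, i.2, rfl⟩
    · rintro ⟨i, hi, rfl⟩; exact ⟨⟨i, hi⟩, rfl⟩
  refine ⟨FreeGroupBasis.ofRepr ((MonoidHom.ofInjective hinj).trans (MulEquiv.subgroupCongr hr)).symm, fun i => ?_⟩
  change ((((MonoidHom.ofInjective hinj).trans (MulEquiv.subgroupCongr hr)) (FreeGroup.of i) : Fd d) : F) = _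
  change FreeGroup.map Fin.val (FreeGroup.of i) = _
  simp

theorem key {h : G} {c d : ℕ} (hh : ∀ i < c, h (FreeGroup.of i) ∈ Fd d) :
    c ≤ d ∧ ∃ g : G, (∀ i < c, g (FreeGroup.of i) = h (FreeGroup.of i)) ∧ Pres g (Fd d) := by
  classical
  obtain ⟨ι, b, hb⟩ := exists_basis ((Fd d).comap h.toMonoidHom)
  let e : (Fd d).comap h.toMonoidHom ≃* Fd d :=
    { toFun := fun w => ⟨h w, w.2⟩
      invFun := fun w => ⟨h.symm w, by simp [Subgroup.mem_comap]⟩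
      left_inv := fun w => by ext; simp
      right_inv := fun w => by ext; simp
      map_mul' := fun x y => Subtype.ext (map_mul h (x : F) (y : F)) }
  have hbi : ∀ i : Fin c, ∃ j, (b j : F) = FreeGroup.of (i : ℕ) := fun i => hb i (hh i i.2)
  choose J hJ using hbi
  obtain ⟨s, hs⟩ := exists_std_basis d
  let b2 : FreeGroupBasis ι (Fd d) := b.map e
  have hb2 : ∀ i : Fin c, (b2 (J i) : F) = h (FreeGroup.of (i : ℕ)) := by
    intro i
    have : b2 (J i) = e (b (J i)) := rfl
    rw [this, ← hJ]; rfl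
  let σ : ι ≃ Fin d := Equiv.ofFreeGroupEquiv (b2.repr.symm.trans s.repr)
  have hJinj : Function.Injective J := by
    intro i j hij
    have := hJ i
    rw [hij, hJ j] at this
    exact Fin.ext (FreeGroup.of_injective this).symm
  have hcd : c ≤ d := by
    simpa using Fintype.card_le_of_injective (fun i => σ (J i)) (σ.injective.comp hJinj)
  refine ⟨hcd, ?_⟩
  let castc : Fin c → Fin d := Fin.castLE hcd
  have hcast : Function.Injective castc := Fin.castLE_injective hcd
  have hSJ : Function.Injective (fun i => σ (J i)) := σ.injective.comp hJinj
  let τ0 : {x // x ∈ Set.range castc} ≃ {x // x ∈ Set.range (fun i => σ (J i))} :=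
    (Equiv.ofInjective _ hcast).symm.trans (Equiv.ofInjective _ hSJ)
  let τ : Equiv.Perm (Fin d) := τ0.extendSubtype
  have hτ : ∀ i : Fin c, τ (castc i) = σ (J i) := by
    intro i
    have h1 := τ0.extendSubtype_apply_of_mem (castc i) ⟨i, rfl⟩
    rw [show τ (castc i) = τ0.extendSubtype (castc i) from rfl, h1]
    simp only [τ0, Equiv.trans_apply]
    have : (Equiv.ofInjective castc hcast).symm ⟨castc i, ⟨i, rfl⟩⟩ = i := by
      rw [Equiv.symm_apply_eq]; rfl
    rw [this]; rfl
  let b3 : FreeGroupBasis (Fin d) (Fd d) := b2.reindex (σ.trans τ.symm)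
  let φ : Fd d ≃* Fd d := s.repr.trans b3.repr.symm
  have hφ : ∀ i : Fin d, φ (s i) = b3 i := by
    intro i
    simp only [φ, MulEquiv.trans_apply]
    rw [show s.repr (s i) = FreeGroup.of i by simp]
    rfl
  obtain ⟨g, hg⟩ := exists_ext φ
  refine ⟨g, ?_, ?_⟩
  · intro i hi
    have h1 : (FreeGroup.of i : F) = (s (castc ⟨i, hi⟩) : F) := by rw [hs]; rfl
    rw [h1, hg, hφ, ← h1]
    have h2 : b3 (castc ⟨i, hi⟩) = b2 (J ⟨i, hi⟩) := by
      simp only [b3, FreeGroupBasis.reindex_apply]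
      congr 1
      simp [hτ]
    rw [h2, hb2]
  · intro w
    constructor
    · intro hw
      have h1 : g (φ.symm ⟨g w, hw⟩ : Fd d) = g w := by rw [hg]; simp
      have := g.injective h1
      rw [← this]; exact (φ.symm ⟨g w, hw⟩).2
    · intro hw
      have := hg ⟨w, hw⟩
      simp only at this
      rw [this]; exact (φ _).2

end SIP


namespace SIP

lemma inv_app (g : G) (w : F) : g⁻¹ (g w) = w := MulAut.inv_apply_self F g w
lemma app_inv (g : G) (w : F) : g (g⁻¹ w) = w := MulAut.apply_inv_self F g w
lemma mul_app (g h : G) (w : F) : (g * h) w = g (h w) := rfl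

lemma Pres.inv {g : G} {C : Subgroup F} (h : Pres g C) : Pres g⁻¹ C := by
  intro w
  rw [← h, app_inv]

lemma Pres.mul {g h : G} {C : Subgroup F} (hg : Pres g C) (hh : Pres h C) : Pres (g * h) C := by
  intro w
  rw [mul_app, hg, hh]

lemma Pres.of_le {g : G} {C : Subgroup F} (h1 : ∀ w ∈ C, g w ∈ C) (h2 : ∀ w ∈ C, g⁻¹ w ∈ C) :
    Pres g C := by
  intro w
  refine ⟨fun h => ?_, h1 w⟩
  have := h2 _ h
  rwa [inv_app] at this

/-- image of `Fd d` under `k` -/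
def img (k : G) (d : ℕ) : Subgroup F := (Fd d).comap (k⁻¹ : G).toMonoidHom

lemma mem_img {k : G} {d : ℕ} {w : F} : w ∈ img k d ↔ k⁻¹ w ∈ Fd d := Iff.rfl

lemma app_mem_img {k : G} {d : ℕ} {w : F} : k w ∈ img k d ↔ w ∈ Fd d := by
  rw [mem_img, inv_app]

lemma img_one (d : ℕ) : img 1 d = Fd d := by
  ext w; rw [mem_img]; simp

lemma img_mul_of_pres {k g : G} {d : ℕ} (hg : Pres g (Fd d)) : img (k * g) d = img k d := by
  ext w
  rw [mem_img, mem_img, mul_inv_rev, mul_app]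
  exact hg.inv _

lemma rel_img {k k1 : G} {c d : ℕ} (h : img k c ≤ img k1 d) :
    c ≤ d ∧ ∃ a : G, img k1 d = img a d ∧ ∀ w ∈ Fd c, a w = k w := by
  obtain ⟨hcd, g, hg1, hg2⟩ := key (h := k1⁻¹ * k) (c := c) (d := d) (by
    intro i hi
    have : k (FreeGroup.of i) ∈ img k1 d := h (app_mem_img.2 (of_mem_Fd hi))
    exact this)
  refine ⟨hcd, k1 * g, (img_mul_of_pres hg2).symm, fun w hw => ?_⟩
  have := eqOn_Fd (f := g.toMonoidHom) (g := (k1⁻¹ * k : G).toMonoidHom) hg1 hw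
  have h3 : g w = k1⁻¹ (k w) := this
  rw [mul_app, h3, app_inv]

section Std
variable (c d1 d2 : ℕ)

/-- the swap -/
def sw (j : ℕ) : ℕ :=
  if c ≤ j ∧ j < d1 then j + (d1 + d2)
  else if c + (d1 + d2) ≤ j ∧ j < d1 + (d1 + d2) then j - (d1 + d2) else j

lemma sw_sw (j : ℕ) : sw c d1 d2 (sw c d1 d2 j) = j := by
  unfold sw; grind

def piA : G := mkAut (fun j => FreeGroup.of (sw c d1 d2 j)) (fun j => FreeGroup.of (sw c d1 d2 j))
  (fun i => by simp [sw_sw]) (fun i => by simp [sw_sw])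

lemma piA_of (j : ℕ) : piA c d1 d2 (FreeGroup.of j) = FreeGroup.of (sw c d1 d2 j) := mkAut_of _ _ _ _ _

lemma piA_fix {w : F} (hw : w ∈ Fd c) : piA c d1 d2 w = w := by
  refine eqOn_Fd (f := (piA c d1 d2).toMonoidHom) (g := MonoidHom.id F) ?_ hw
  intro i hi
  change piA c d1 d2 (FreeGroup.of i) = FreeGroup.of i
  rw [piA_of]; congr 1; unfold sw; grind

lemma piA_mem {w : F} (hcd : c ≤ d1) (hw : w ∈ Fd d1) : piA c d1 d2 w ∈ Fd (d1 + (d1 + d2)) := by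
  have : Fd d1 ≤ (Fd (d1 + (d1 + d2))).comap (piA c d1 d2).toMonoidHom := by
    apply Fd_le
    intro i hi
    change piA c d1 d2 (FreeGroup.of i) ∈ Fd (d1 + (d1 + d2))
    rw [piA_of]
    apply of_mem_Fd
    unfold sw; grind
  exact this hw

def zFun (X Y : G) (j : ℕ) : F :=
  if j < d2 then X (FreeGroup.of j)
  else if c + (d1 + d2) ≤ j ∧ j < d1 + (d1 + d2) then
    piA c d1 d2 (Y (FreeGroup.of (j - (d1 + d2)))) else FreeGroup.of j

structure ZHyp (X Y : G) : Prop where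
  hc1 : c ≤ d1
  hc2 : c ≤ d2
  hX : Pres X (Fd d2)
  hY : Pres Y (Fd d1)
  hYc : Pres Y (Fd c)
  hXY : ∀ w ∈ Fd c, X w = Y w

variable {c d1 d2} {X Y : G}

lemma ZHyp.inv (h : ZHyp c d1 d2 X Y) : ZHyp c d1 d2 X⁻¹ Y⁻¹ where
  hc1 := h.hc1
  hc2 := h.hc2
  hX := h.hX.inv
  hY := h.hY.inv
  hYc := h.hYc.inv
  hXY := by
    intro w hw
    have h1 := h.hXY (Y⁻¹ w) ((h.hYc.inv w).2 hw)
    rw [app_inv] at h1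
    rw [← h1, inv_app, h1]

lemma zFun_X {w : F} (hw : w ∈ Fd d2) : FreeGroup.lift (zFun c d1 d2 X Y) w = X w := by
  refine eqOn_Fd (g := X.toMonoidHom) ?_ hw
  intro i hi
  change _ = X (FreeGroup.of i)
  simp [zFun, hi]

lemma zFun_Y (h : ZHyp c d1 d2 X Y) {w : F} (hw : w ∈ Fd d1) :
    FreeGroup.lift (zFun c d1 d2 X Y) (piA c d1 d2 w) = piA c d1 d2 (Y w) := by
  refine eqOn_Fd (f := (FreeGroup.lift (zFun c d1 d2 X Y)).comp (piA c d1 d2).toMonoidHom)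
    (g := (piA c d1 d2 * Y : G).toMonoidHom) ?_ hw
  intro i hi
  change FreeGroup.lift (zFun c d1 d2 X Y) (piA c d1 d2 (FreeGroup.of i)) =
    piA c d1 d2 (Y (FreeGroup.of i))
  have := h.hc2
  by_cases hic : i < c
  · rw [piA_fix c d1 d2 (of_mem_Fd hic), zFun_X (of_mem_Fd (by omega)), h.hXY _ (of_mem_Fd hic),
      piA_fix c d1 d2 ((h.hYc _).2 (of_mem_Fd hic))]
  · rw [piA_of]
    have h1 : sw c d1 d2 i = i + (d1 + d2) := by unfold sw; grind
    rw [h1, FreeGroup.lift_apply_of]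
    unfold zFun
    rw [if_neg (by omega), if_pos (by omega), Nat.add_sub_cancel]

lemma zFun_inv (h : ZHyp c d1 d2 X Y) (j : ℕ) :
    FreeGroup.lift (zFun c d1 d2 X Y) (zFun c d1 d2 X⁻¹ Y⁻¹ j) = FreeGroup.of j := by
  have := h.hc1
  have := h.hc2
  by_cases h1 : j < d2
  · have h2 : zFun c d1 d2 X⁻¹ Y⁻¹ j = X⁻¹ (FreeGroup.of j) := by simp only [zFun, h1, if_true]
    rw [h2, zFun_X ((h.hX.inv _).2 (of_mem_Fd h1)), app_inv]
  · by_cases h3 : c + (d1 + d2) ≤ j ∧ j < d1 + (d1 + d2)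
    · have h2 : zFun c d1 d2 X⁻¹ Y⁻¹ j = piA c d1 d2 (Y⁻¹ (FreeGroup.of (j - (d1 + d2)))) := by
        simp only [zFun, h1, h3, if_false]; simp
      rw [h2, zFun_Y h ((h.hY.inv _).2 (of_mem_Fd (by omega))), app_inv, piA_of]
      congr 1; unfold sw; grind
    · have h2 : ∀ X Y, zFun c d1 d2 X Y j = FreeGroup.of j := by
        intro X Y
        simp only [zFun, h1, h3, if_false]
      rw [h2, FreeGroup.lift_apply_of, h2]

def zA (h : ZHyp c d1 d2 X Y) : G :=
  mkAut (zFun c d1 d2 X Y) (zFun c d1 d2 X⁻¹ Y⁻¹) (zFun_inv h)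
    (by have := zFun_inv h.inv; simpa only [inv_inv] using this)

lemma zFun_mem (h : ZHyp c d1 d2 X Y) {w : F} (hw : w ∈ Fd (d1 + (d1 + d2))) :
    FreeGroup.lift (zFun c d1 d2 X Y) w ∈ Fd (d1 + (d1 + d2)) := by
  have : Fd (d1 + (d1 + d2)) ≤ (Fd (d1 + (d1 + d2))).comap (FreeGroup.lift (zFun c d1 d2 X Y)) := by
    apply Fd_le
    intro i hi
    change FreeGroup.lift (zFun c d1 d2 X Y) (FreeGroup.of i) ∈ Fd (d1 + (d1 + d2))
    rw [FreeGroup.lift_apply_of]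
    unfold zFun
    split_ifs with h1 h2
    · exact Fd_mono (by omega) ((h.hX _).2 (of_mem_Fd h1))
    · exact piA_mem _ _ _ h.hc1 ((h.hY _).2 (of_mem_Fd (by omega)))
    · exact of_mem_Fd hi
  exact this hw

lemma exists_z (h : ZHyp c d1 d2 X Y) : ∃ Z : G, Pres Z (Fd (d1 + (d1 + d2))) ∧
    (∀ w ∈ Fd d2, Z w = X w) ∧ ∀ w ∈ Fd d1, Z (piA c d1 d2 w) = piA c d1 d2 (Y w) :=
  ⟨zA h, Pres.of_le (fun _ hw => zFun_mem h hw) (fun _ hw => zFun_mem h.inv hw),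
    fun _ hw => zFun_X hw, fun _ hw => zFun_Y h hw⟩

end Std

/-- The class of standard subgroups. -/
def IsC (C : Subgroup F) : Prop := ∃ k d, C = img k d

/-- `C` is an invariant standard subgroup for the first `n` entries of `x`. -/
structure Inv (n : ℕ) (x : ℕ → G) (C : Subgroup F) : Prop where
  isC : IsC C
  pres : ∀ i < n, Pres (x i) C

theorem amalgam {m : ℕ} {x y : ℕ → G} {C C1 C2 : Subgroup F} (hC : IsC C)
    (hy : Inv m y C1) (hx : Inv m x C2) (h1 : C ≤ C1) (h2 : C ≤ C2)
    (hxC : ∀ i < m, Pres (x i) C) (hxy : ∀ i < m, ∀ w ∈ C, x i w = y i w) :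
    ∃ f0 : G, (∀ w ∈ C, f0 w = w) ∧ ∃ C3, C2 ≤ C3 ∧ (∀ w ∈ C1, f0 w ∈ C3) ∧
      ∃ z : ℕ → G, Inv m z C3 ∧ (∀ i < m, ∀ w ∈ C2, z i w = x i w) ∧
        ∀ i < m, ∀ w ∈ C1, z i (f0 w) = f0 (y i w) := by
  obtain ⟨k, c, rfl⟩ := hC
  obtain ⟨⟨k1, d1, rfl⟩, hy⟩ := hy
  obtain ⟨⟨k2, d2, rfl⟩, hx⟩ := hx
  obtain ⟨hc1, a1, e1, ha1⟩ := rel_img h1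
  obtain ⟨hc2, a2, e2, ha2⟩ := rel_img h2
  rw [e1] at h1 hy ⊢
  rw [e2] at h2 hx ⊢
  have hmem : ∀ (a b : G) (d : ℕ), Pres b (img a d) → Pres (a⁻¹ * b * a) (Fd d) := by
    intro a b d hb w
    rw [mul_app, mul_app, ← mem_img, hb, app_mem_img]
  have hcc : ∀ (a : G), (∀ w ∈ Fd c, a w = k w) → img a c = img k c := by
    intro a ha
    have : ∀ w ∈ Fd c, (k⁻¹ * a) w = w := fun w hw => by rw [mul_app, ha w hw, inv_app]
    have : Pres (k⁻¹ * a) (Fd c) := Pres.of_le (fun w hw => by rw [this w hw]; exact hw) (fun w hw => by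
      have h3 := this w hw
      have : (k⁻¹ * a)⁻¹ w = w := by
        conv_lhs => rw [← h3]
        rw [inv_app]
      rw [this]; exact hw)
    have h4 := img_mul_of_pres (k := k) this
    rwa [mul_inv_cancel_left] at h4
  have hz : ∀ i < m, ZHyp c d1 d2 (a2⁻¹ * x i * a2) (a1⁻¹ * y i * a1) := by
    intro i hi
    have hyC : Pres (y i) (img k c) := Pres.of_le (fun w hw => by
        rw [← hxy i hi w hw, hxC i hi]; exact hw) (fun w hw => by
        have h5 := hxy i hi ((x i)⁻¹ w) (((hxC i hi).inv w).2 hw)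
        rw [app_inv] at h5
        rw [h5, inv_app]
        exact ((hxC i hi).inv w).2 hw)
    refine ⟨hc1, hc2, hmem _ _ _ (hx i hi), hmem _ _ _ (hy i hi), ?_, ?_⟩
    · apply hmem; rw [hcc a1 ha1]; exact hyC
    · intro w hw
      have hkw : k w ∈ img k c := app_mem_img.2 hw
      simp only [mul_app]
      rw [ha1 w hw, ha2 w hw, ← hxy i hi _ hkw]
      have h6 : k⁻¹ (x i (k w)) ∈ Fd c := (hxC i hi _).2 hkw
      have h7 := ha1 _ h6
      have h8 := ha2 _ h6
      rw [app_inv] at h7 h8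
      have h9 := congrArg (fun v => a1⁻¹ v) h7
      have h10 := congrArg (fun v => a2⁻¹ v) h8
      simp only [inv_app] at h9 h10
      rw [← h9, ← h10]
  have hZ : ∀ i, ∃ Z : G, i < m → Pres Z (Fd (d1 + (d1 + d2))) ∧
    (∀ w ∈ Fd d2, Z w = (a2⁻¹ * x i * a2) w) ∧
      ∀ w ∈ Fd d1, Z (piA c d1 d2 w) = piA c d1 d2 ((a1⁻¹ * y i * a1) w) := by
    intro i
    by_cases hi : i < m
    · obtain ⟨Z, hZ⟩ := exists_z (hz i hi)
      exact ⟨Z, fun _ => hZ⟩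
    · exact ⟨1, fun h => absurd h hi⟩
  choose Z hZ using hZ
  refine ⟨a2 * piA c d1 d2 * a1⁻¹, ?_, img a2 (d1 + (d1 + d2)), ?_, ?_,
    fun i => a2 * Z i * a2⁻¹, ⟨⟨_, _, rfl⟩, ?_⟩, ?_, ?_⟩
  · intro w hw
    rw [← hcc a1 ha1, mem_img] at hw
    simp only [mul_app]
    rw [piA_fix _ _ _ hw, ha2 _ hw, ← ha1 _ hw, app_inv]
  · intro w hw
    exact Fd_mono (by omega) hw
  · intro w hw
    simp only [mul_app]
    rw [app_mem_img]
    exact piA_mem _ _ _ hc1 hw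
  · intro i hi w
    simp only [mul_app]
    rw [app_mem_img, (hZ i hi).1]
    rfl
  · intro i hi w hw
    simp only [mul_app]
    rw [mem_img] at hw
    rw [(hZ i hi).2.1 _ hw]
    simp only [mul_app, app_inv]
  · intro i hi w hw
    simp only [mul_app, inv_app]
    rw [mem_img] at hw
    rw [(hZ i hi).2.2 _ hw]
    simp only [mul_app, app_inv]

end SIP


namespace SIP

/-- Fusion of a coherent sequence of automorphisms. -/
theorem fusion (h : ℕ → G) (A : ℕ → Set F) (hA : ∀ n, A n ⊆ A (n + 1))
    (hh : ∀ n, ∀ a ∈ A n, h (n + 1) a = h n a) (h1 : ∀ e, ∃ n, e ∈ A n)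
    (h2 : ∀ e, ∃ n, (h n)⁻¹ e ∈ A n) : ∃ g : G, ∀ n, ∀ a ∈ A n, g a = h n a := by
  have hmono : Monotone A := monotone_nat_of_le_succ hA
  have hcoh : ∀ n m, n ≤ m → ∀ a ∈ A n, h m a = h n a := by
    intro n m hnm
    induction m, hnm using Nat.le_induction with
    | base => intro a _; rfl
    | succ m hnm ih =>
      intro a ha
      rw [hh m a (hmono hnm ha), ih a ha]
  choose N hN using h1
  have hdef : ∀ n, ∀ a ∈ A n, h (N a) a = h n a := by
    intro n a ha
    rcases le_total n (N a) with h' | h'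
    · exact hcoh _ _ h' _ ha
    · exact (hcoh _ _ h' _ (hN a)).symm
  let φ : F →* F := MonoidHom.mk' (fun a => h (N a) a) (by
    intro u v
    let m := max (N u) (max (N v) (N (u * v)))
    have e1 := hdef m u (hmono (by simp [m]) (hN u))
    have e2 := hdef m v (hmono (by simp [m]) (hN v))
    have e3 := hdef m (u * v) (hmono (by simp [m]) (hN (u * v)))
    simp only [e1, e2, e3, map_mul])
  have hφ : ∀ n, ∀ a ∈ A n, φ a = h n a := hdef
  have hinj : Function.Injective φ := by
    intro u v huv
    let m := max (N u) (N v)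
    rw [hφ m u (hmono (by simp [m]) (hN u)), hφ m v (hmono (by simp [m]) (hN v))] at huv
    exact (h m).injective huv
  have hsurj : Function.Surjective φ := by
    intro e
    obtain ⟨n, hn⟩ := h2 e
    exact ⟨_, by rw [hφ n _ hn, app_inv]⟩
  exact ⟨MulEquiv.ofBijective φ ⟨hinj, hsurj⟩, hφ⟩

/-- `D` contains a dense open set. -/
def DO (D : Set G) : Prop := ∀ (h : G) (A : Finset F), ∃ h' : G, (∀ a ∈ A, h' a = h a) ∧
  ∃ A' : Finset F, ∀ k : G, (∀ a ∈ A', k a = h' a) → k ∈ D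

lemma DO.translate {D : Set G} (hD : DO D) (g : G) : DO {z | z * g ∈ D} := by
  classical
  intro h A
  obtain ⟨z, hz, A', hA'⟩ := hD (h * g) (A.image (fun a => g⁻¹ a))
  refine ⟨z * g⁻¹, ?_, A'.image (fun a => g a), ?_⟩
  · intro a ha
    have := hz (g⁻¹ a) (Finset.mem_image_of_mem _ ha)
    rw [mul_app, this, mul_app, app_inv]
  · intro k hk
    apply hA'
    intro a ha
    have := hk (g a) (Finset.mem_image_of_mem _ ha)
    rw [mul_app, this, mul_app, inv_app]

/-- basic open conditions -/
abbrev S := G × Finset F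

def Ext (p q : S) : Prop := p.2 ⊆ q.2 ∧ ∀ a ∈ p.2, q.1 a = p.1 a

lemma Ext.refl (p : S) : Ext p p := ⟨Finset.Subset.refl _, fun _ _ => rfl⟩

lemma Ext.trans {p q r : S} (h1 : Ext p q) (h2 : Ext q r) : Ext p r :=
  ⟨h1.1.trans h2.1, fun a ha => by rw [h2.2 a (h1.1 ha), h1.2 a ha]⟩

def Mem (k : G) (p : S) : Prop := ∀ a ∈ p.2, k a = p.1 a

lemma Mem.of_ext {k : G} {p q : S} (h : Ext p q) (hk : Mem k q) : Mem k p :=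
  fun a ha => by rw [hk a (h.1 ha), h.2 a ha]

/-- `e` has been taken care of -/
def Cov (e : F) (p : S) : Prop := e ∈ p.2 ∧ p.1⁻¹ e ∈ p.2

lemma exists_cov (e : F) (p : S) : ∃ q, Ext p q ∧ Cov e q := by
  classical
  refine ⟨(p.1, p.2 ∪ {e, p.1⁻¹ e}), ⟨Finset.subset_union_left, fun _ _ => rfl⟩, ?_, ?_⟩ <;> simp

lemma DO.step {D : Set G} (hD : DO D) (p : S) : ∃ q, Ext p q ∧ ∀ k, Mem k q → k ∈ D := by
  classical
  obtain ⟨h', h1, A', h2⟩ := hD p.1 p.2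
  refine ⟨(h', p.2 ∪ A'), ⟨Finset.subset_union_left, h1⟩, fun k hk => h2 k fun a ha => hk a ?_⟩
  simp [ha]

lemma fusionS (p : ℕ → S) (hp : ∀ n, Ext (p n) (p (n + 1))) (hc : ∀ e, ∃ n, Cov e (p n)) :
    ∃ g : G, ∀ n, Mem g (p n) := by
  refine fusion (fun n => (p n).1) (fun n => (p n).2) (fun n => ?_) (fun n => (hp n).2) ?_ ?_
  · exact_mod_cast (hp n).1
  · exact fun e => (hc e).imp fun n h => by exact_mod_cast h.1
  · exact fun e => (hc e).imp fun n h => by exact_mod_cast h.2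

theorem baire (D : ℕ → Set G) (hD : ∀ n, DO (D n)) (p : S) :
    ∃ g : G, Mem g p ∧ ∀ n, g ∈ D n := by
  obtain ⟨e, he⟩ := exists_surjective_nat F
  have hst : ∀ n (p : S), ∃ q, Ext p q ∧ (∀ k, Mem k q → k ∈ D n) ∧ Cov (e n) q := by
    intro n p
    obtain ⟨q, h1, h2⟩ := (hD n).step p
    obtain ⟨r, h3, h4⟩ := exists_cov (e n) q
    exact ⟨r, h1.trans h3, fun k hk => h2 k (hk.of_ext h3), h4⟩
  choose st h1 h2 h3 using hst
  let P : ℕ → S := fun n => Nat.rec p (fun n p => st n p) n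
  obtain ⟨g, hg⟩ := fusionS P (fun n => h1 n _) (fun w => by
    obtain ⟨n, rfl⟩ := he w
    exact ⟨n + 1, h3 n _⟩)
  exact ⟨g, hg 0, fun n => h2 n _ _ (hg (n + 1))⟩

lemma pair_step {D : Set G} (hD : DO D) (p q : S) : ∃ p' q', Ext p p' ∧ Ext q q' ∧
    ∀ k1 k2, Mem k1 p' → Mem k2 q' → k1⁻¹ * k2 ∈ D := by
  classical
  obtain ⟨z, hz, A', hA'⟩ := hD (p.1⁻¹ * q.1) q.2
  refine ⟨(p.1, p.2 ∪ A'.image (fun a => z a)), (p.1 * z, q.2 ∪ A'),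
    ⟨Finset.subset_union_left, fun _ _ => rfl⟩, ⟨Finset.subset_union_left, ?_⟩, ?_⟩
  · intro a ha
    simp only [mul_app]
    rw [hz a ha, mul_app, app_inv]
  · intro k1 k2 h1 h2
    apply hA'
    intro a ha
    have e2 := h2 a (Finset.mem_union_right _ ha)
    have e1 := h1 (z a) (Finset.mem_union_right _ (Finset.mem_image_of_mem _ ha))
    simp only [mul_app] at e1 e2 ⊢
    rw [e2, ← e1, inv_app]

lemma family_step {D : Set G} (hD : DO D) {I : Type} [Fintype I] (p : I → S) :
    ∃ q : I → S, (∀ i, Ext (p i) (q i)) ∧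
      ∀ i j, i ≠ j → ∀ k1 k2, Mem k1 (q i) → Mem k2 (q j) → k1⁻¹ * k2 ∈ D := by
  classical
  have : ∀ T : Finset (I × I), ∃ q : I → S, (∀ i, Ext (p i) (q i)) ∧
      ∀ ij ∈ T, ij.1 ≠ ij.2 → ∀ k1 k2, Mem k1 (q ij.1) → Mem k2 (q ij.2) → k1⁻¹ * k2 ∈ D := by
    intro T
    induction T using Finset.induction_on with
    | empty => exact ⟨p, fun i => Ext.refl _, by simp⟩
    | insert ij T _ ih =>
      obtain ⟨q, hq, hq2⟩ := ih
      by_cases hne : ij.1 = ij.2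
      · refine ⟨q, hq, ?_⟩
        intro ab hab hab'
        rcases Finset.mem_insert.1 hab with rfl | hab
        · exact absurd hne hab'
        · exact hq2 ab hab hab'
      · obtain ⟨r, s, hr, hs, hrs⟩ := pair_step hD (q ij.1) (q ij.2)
        let q' : I → S := Function.update (Function.update q ij.1 r) ij.2 s
        have e1 : q' ij.1 = r := by simp [q', hne]
        have e2 : q' ij.2 = s := by simp [q']
        have hqq' : ∀ i, Ext (q i) (q' i) := by
          intro i
          by_cases h2 : i = ij.2
          · rw [h2, e2]; exact hs
          · by_cases h1 : i = ij.1
            · rw [h1, e1]; exact hr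
            · simp only [q', Function.update_of_ne h2, Function.update_of_ne h1]; exact Ext.refl _
        refine ⟨q', fun i => (hq i).trans (hqq' i), ?_⟩
        intro ab hab hab'
        rcases Finset.mem_insert.1 hab with rfl | hab
        · rw [e1, e2]; exact hrs
        · intro k1 k2 h1 h2
          exact hq2 ab hab hab' k1 k2 (h1.of_ext (hqq' _)) (h2.of_ext (hqq' _))
  obtain ⟨q, h1, h2⟩ := this Finset.univ
  exact ⟨q, h1, fun i j hij => h2 (i, j) (Finset.mem_univ _) hij⟩

theorem perfect (D : ℕ → Set G) (hD : ∀ n, DO (D n)) :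
    ∃ φ : (ℕ → Bool) → G, ∀ a b, a ≠ b → ∀ m, (φ a)⁻¹ * φ b ∈ D m := by
  obtain ⟨e, he⟩ := exists_surjective_nat F
  have hst : ∀ n (p : (Fin n → Bool) → S), ∃ q : (Fin (n + 1) → Bool) → S,
      (∀ v, Ext (p (fun i => v i.castSucc)) (q v)) ∧
      (∀ u v, u ≠ v → ∀ k1 k2, Mem k1 (q u) → Mem k2 (q v) → k1⁻¹ * k2 ∈ D (Nat.unpair n).1) ∧
      ∀ v, Cov (e n) (q v) := by
    intro n p
    obtain ⟨q, h1, h2⟩ := family_step (hD (Nat.unpair n).1)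
      (fun v : Fin (n + 1) → Bool => p (fun i => v i.castSucc))
    choose r h3 h4 using fun v => exists_cov (e n) (q v)
    exact ⟨r, fun v => (h1 v).trans (h3 v), fun u v huv k1 k2 hk1 hk2 =>
      h2 u v huv k1 k2 (hk1.of_ext (h3 _)) (hk2.of_ext (h3 _)), h4⟩
  choose st h1 h2 h3 using hst
  let P : ∀ n, (Fin n → Bool) → S := fun n => Nat.rec (fun _ => (1, ∅)) (fun n p => st n p) n
  have hφ : ∀ a : ℕ → Bool, ∃ g : G, ∀ n, Mem g (P n (fun i => a i)) := by
    intro a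
    refine fusionS (fun n => P n (fun i => a i)) (fun n => ?_) (fun w => ?_)
    · exact h1 n (P n) (fun i => a i)
    · obtain ⟨n, rfl⟩ := he w
      exact ⟨n + 1, h3 n (P n) (fun i => a i)⟩
  choose φ hφ using hφ
  refine ⟨φ, fun a b hab m => ?_⟩
  obtain ⟨n0, hn0⟩ := Function.ne_iff.1 hab
  have := h2 (Nat.pair m n0) (P _) (fun i => a i) (fun i => b i) (by
    intro heq
    have h5 : n0 < Nat.pair m n0 + 1 := Nat.lt_succ_of_le (Nat.right_le_pair m n0)
    exact hn0 (congrFun heq ⟨n0, h5⟩)) (φ a) (φ b) (hφ a (Nat.pair m n0 + 1)) (hφ b (Nat.pair m n0 + 1))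
  rwa [Nat.unpair_pair] at this

end SIP


namespace SIP

lemma Pres.congr {g g' : G} {C : Subgroup F} (h : Pres g C) (hg : ∀ w ∈ C, g' w = g w) :
    Pres g' C := by
  refine Pres.of_le (fun w hw => by rw [hg w hw, h]; exact hw) (fun w hw => ?_)
  have h1 := (h.inv w).2 hw
  have h2 := hg _ h1
  rw [app_inv] at h2
  have h3 : g'⁻¹ w = g⁻¹ w := by
    conv_lhs => rw [← h2]
    rw [inv_app]
  rw [h3]; exact h1

lemma img_congr {k k' : G} {d : ℕ} (h : ∀ i < d, k' (FreeGroup.of i) = k (FreeGroup.of i)) :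
    img k' d = img k d := by
  have h0 : ∀ w ∈ Fd d, k' w = k w := fun w hw =>
    eqOn_Fd (f := k'.toMonoidHom) (g := k.toMonoidHom) h hw
  have h1 : Pres (k⁻¹ * k') (Fd d) := by
    refine Pres.congr (g := 1) (fun w => Iff.rfl) (fun w hw => ?_)
    rw [mul_app, h0 w hw, inv_app]; rfl
  have := img_mul_of_pres (k := k) h1
  rwa [mul_inv_cancel_left] at this

lemma eqOn_img {g g' k : G} {d : ℕ}
    (h : ∀ i < d, g (k (FreeGroup.of i)) = g' (k (FreeGroup.of i))) :
    ∀ w ∈ img k d, g w = g' w := by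
  intro w hw
  have := eqOn_Fd (f := (g * k : G).toMonoidHom) (g := (g' * k : G).toMonoidHom) h (mem_img.1 hw)
  have h2 : g (k (k⁻¹ w)) = g' (k (k⁻¹ w)) := this
  rwa [app_inv] at h2

/-- finite generating sets -/
lemma IsC.gens {C : Subgroup F} (hC : IsC C) : ∃ A : Finset F, (∀ a ∈ A, a ∈ C) ∧
    (∀ g g' : G, (∀ a ∈ A, g a = g' a) → ∀ w ∈ C, g w = g' w) ∧
    ∀ K : Subgroup F, (∀ a ∈ A, a ∈ K) → C ≤ K := by
  classical
  obtain ⟨k, d, rfl⟩ := hC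
  refine ⟨(Finset.range d).image (fun i => k (FreeGroup.of i)), ?_, ?_, ?_⟩
  · intro a ha
    simp only [Finset.mem_image, Finset.mem_range] at ha
    obtain ⟨i, hi, rfl⟩ := ha
    exact app_mem_img.2 (of_mem_Fd hi)
  · intro g g' h
    apply eqOn_img
    intro i hi
    exact h _ (Finset.mem_image_of_mem _ (Finset.mem_range.2 hi))
  · intro K hK w hw
    have : Fd d ≤ K.comap k.toMonoidHom := Fd_le (fun i hi =>
      hK _ (Finset.mem_image_of_mem _ (Finset.mem_range.2 hi)))
    have h2 : k (k⁻¹ w) ∈ K := this hw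
    rwa [app_inv] at h2

/-- image of a subgroup -/
def cmap (g : G) (C : Subgroup F) : Subgroup F := C.comap (g⁻¹ : G).toMonoidHom

lemma mem_cmap {g : G} {C : Subgroup F} {w : F} : w ∈ cmap g C ↔ g⁻¹ w ∈ C := Iff.rfl

lemma app_mem_cmap {g : G} {C : Subgroup F} {w : F} : g w ∈ cmap g C ↔ w ∈ C := by
  rw [mem_cmap, inv_app]

lemma IsC.cmap {C : Subgroup F} (hC : IsC C) (g : G) : IsC (cmap g C) := by
  obtain ⟨k, d, rfl⟩ := hC
  refine ⟨g * k, d, ?_⟩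
  ext w
  rw [mem_cmap, mem_img, mem_img, mul_inv_rev, mul_app]

structure Good (n : ℕ) (x : ℕ → G) : Prop where
  cof : ∀ A : Finset F, ∃ C, Inv n x C ∧ ∀ a ∈ A, a ∈ C
  ext : ∀ (C C1 : Subgroup F) (y : ℕ → G), Inv n x C → Inv n y C1 → C ≤ C1 →
    (∀ i < n, ∀ w ∈ C, y i w = x i w) →
    ∃ f : G, (∀ w ∈ C, f w = w) ∧ ∀ i < n, ∀ w ∈ C1, f (y i w) = x i (f w)

lemma good_zero (x : ℕ → G) : Good 0 x where
  cof := by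
    intro A
    obtain ⟨d, hd⟩ := exists_finite_subset_Fd A.finite_toSet
    exact ⟨Fd d, ⟨⟨1, d, (img_one d).symm⟩, by simp⟩, fun a ha => hd ha⟩
  ext := by
    intro C C1 y _ _ _ _
    exact ⟨1, fun _ _ => rfl, by simp⟩

/-- partial conjugacy -/
structure St (n : ℕ) (x x' : ℕ → G) (g : G) (C : Subgroup F) : Prop where
  inv : Inv n x' C
  comm : ∀ i < n, ∀ w ∈ C, g (x' i w) = x i (g w)

lemma St.symm {n : ℕ} {x x' : ℕ → G} {g : G} {C : Subgroup F} (h : St n x x' g C) :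
    St n x' x g⁻¹ (cmap g C) := by
  have hc : ∀ i < n, ∀ w ∈ cmap g C, g⁻¹ (x i w) = x' i (g⁻¹ w) := by
    intro i hi w hw
    have := h.comm i hi _ hw
    have h2 : g (x' i (g⁻¹ w)) = x i (g (g⁻¹ w)) := this
    rw [app_inv] at h2
    rw [← h2, inv_app]
  refine ⟨⟨h.inv.isC.cmap g, fun i hi => ?_⟩, hc⟩
  have hp : Pres (g * x' i * g⁻¹) (cmap g C) := by
    intro w
    simp only [mul_app]
    rw [app_mem_cmap, h.inv.pres i hi]; rfl
  refine hp.congr (fun w hw => ?_)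
  simp only [mul_app]
  rw [← hc i hi w hw, app_inv]

lemma St.forth {n : ℕ} {x x' : ℕ → G} (hx : Good n x) (hx' : Good n x') {g : G} {C : Subgroup F}
    (h : St n x x' g C) (e : F) : ∃ g1 C1, C ≤ C1 ∧ e ∈ C1 ∧ (∀ w ∈ C, g1 w = g w) ∧
      St n x x' g1 C1 := by
  classical
  obtain ⟨A, hA1, hA2, hA3⟩ := h.inv.isC.gens
  obtain ⟨C1, hC1, hAC1⟩ := hx'.cof (insert e A)
  have hCC1 : C ≤ C1 := hA3 C1 (fun a ha => hAC1 a (Finset.mem_insert_of_mem ha))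
  have hs := h.symm
  obtain ⟨f, hf1, hf2⟩ := hx.ext (cmap g C) (cmap g C1) (fun i => g * x' i * g⁻¹) hs.inv
    ⟨hC1.isC.cmap g, fun i hi w => by
      simp only [mul_app]
      rw [app_mem_cmap, hC1.pres i hi]; rfl⟩
    (fun w hw => hCC1 hw) (fun i hi w hw => by
      simp only [mul_app]
      rw [← hs.comm i hi w hw, app_inv])
  refine ⟨f * g, C1, hCC1, hAC1 e (Finset.mem_insert_self _ _), ?_, hC1, ?_⟩
  · intro w hw
    exact hf1 _ (app_mem_cmap.2 hw)
  · intro i hi w hw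
    have := hf2 i hi (g w) (app_mem_cmap.2 hw)
    simp only [mul_app, inv_app] at this ⊢
    exact this

lemma St.step {n : ℕ} {x x' : ℕ → G} (hx : Good n x) (hx' : Good n x') {g : G} {C : Subgroup F}
    (h : St n x x' g C) (e : F) : ∃ g1 C1, C ≤ C1 ∧ e ∈ C1 ∧ g1⁻¹ e ∈ C1 ∧ (∀ w ∈ C, g1 w = g w) ∧
      St n x x' g1 C1 := by
  obtain ⟨g1, C1, h1, h2, h3, h4⟩ := h.forth hx hx' e
  obtain ⟨g2, C2, k1, k2, k3, k4⟩ := h4.symm.forth hx' hx e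
  refine ⟨g2⁻¹, cmap g2 C2, ?_, ?_, ?_, ?_, k4.symm⟩
  case refine_1 =>
    intro w hw
    have := k3 (g1 w) (app_mem_cmap.2 (h1 hw))
    rw [inv_app] at this
    rw [← this]
    exact app_mem_cmap.2 (k1 (app_mem_cmap.2 (h1 hw)))
  case refine_2 =>
    have := k3 (g1 e) (app_mem_cmap.2 h2)
    rw [inv_app] at this
    rw [← this]
    exact app_mem_cmap.2 (k1 (app_mem_cmap.2 h2))
  case refine_3 =>
    rw [inv_inv]; exact app_mem_cmap.2 k2
  case refine_4 =>
    intro w hw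
    have := k3 (g1 w) (app_mem_cmap.2 (h1 hw))
    rw [inv_app] at this
    conv_lhs => rw [← this]
    rw [inv_app, h3 w hw]

theorem homog {n : ℕ} {x x' : ℕ → G} (hx : Good n x) (hx' : Good n x') {C : Subgroup F}
    (hC : Inv n x' C) (hxx : ∀ i < n, ∀ w ∈ C, x' i w = x i w) :
    ∃ f : G, (∀ w ∈ C, f w = w) ∧ ∀ i < n, f * x' i = x i * f := by
  obtain ⟨e, he⟩ := exists_surjective_nat F
  have h0 : St n x x' 1 C := ⟨hC, hxx⟩
  have hst : ∀ m (p : {p : G × Subgroup F // St n x x' p.1 p.2}),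
      ∃ q : {p : G × Subgroup F // St n x x' p.1 p.2}, p.1.2 ≤ q.1.2 ∧ e m ∈ q.1.2 ∧
        q.1.1⁻¹ (e m) ∈ q.1.2 ∧ ∀ w ∈ p.1.2, q.1.1 w = p.1.1 w := by
    intro m p
    obtain ⟨g1, C1, h1, h2, h3, h4, h5⟩ := p.2.step hx hx' (e m)
    exact ⟨⟨(g1, C1), h5⟩, h1, h2, h3, h4⟩
  choose st h1 h2 h3 h4 using hst
  let P : ℕ → {p : G × Subgroup F // St n x x' p.1 p.2} :=
    fun m => Nat.rec ⟨(1, C), h0⟩ (fun m p => st m p) m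
  have hcov : ∀ w, ∃ m, w ∈ (P m).1.2 := fun w => by
    obtain ⟨m, rfl⟩ := he w
    exact ⟨m + 1, h2 m _⟩
  obtain ⟨f, hf⟩ := fusion (fun m => (P m).1.1) (fun m => (P m).1.2)
    (fun m => h1 m (P m)) (fun m => h4 m (P m)) hcov (fun w => by
      obtain ⟨m, rfl⟩ := he w
      exact ⟨m + 1, h3 m _⟩)
  refine ⟨f, hf 0, fun i hi => ?_⟩
  ext1 w
  obtain ⟨m, hm⟩ := hcov w
  rw [mul_app, mul_app, hf m w hm, hf m _ (((P m).2.inv.pres i hi w).2 hm), (P m).2.comm i hi w hm]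

/-- key density fact -/
lemma dense1 {n : ℕ} {x : ℕ → G} (hx : Good n x) (h : G) (K : Finset F) :
    ∃ (z : G) (C : Subgroup F), (∀ a ∈ K, z a = h a) ∧ Inv n x C ∧ Pres z C ∧ ∀ a ∈ K, a ∈ C := by
  classical
  obtain ⟨c, hc⟩ := exists_finite_subset_Fd K.finite_toSet
  obtain ⟨C, hC, hC2⟩ := hx.cof ((Finset.range c).image (fun i => FreeGroup.of i) ∪
    (Finset.range c).image (fun i => h (FreeGroup.of i)))
  have m1 : ∀ i < c, FreeGroup.of i ∈ C := fun i hi => hC2 _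
    (Finset.mem_union_left _ (Finset.mem_image_of_mem _ (Finset.mem_range.2 hi)))
  have m2 : ∀ i < c, h (FreeGroup.of i) ∈ C := fun i hi => hC2 _
    (Finset.mem_union_right _
      (Finset.mem_image_of_mem (fun i => h (FreeGroup.of i)) (Finset.mem_range.2 hi)))
  have hFC : Fd c ≤ C := Fd_le m1
  obtain ⟨k, d, hCk⟩ := hC.isC
  obtain ⟨-, g1, hg1, hp1⟩ := key (h := k⁻¹) (c := c) (d := d) (fun i hi => by
    have := m1 i hi; rw [hCk] at this; exact this)
  obtain ⟨-, g2, hg2, hp2⟩ := key (h := k⁻¹ * h) (c := c) (d := d) (fun i hi => by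
    have := m2 i hi; rw [hCk] at this; exact this)
  refine ⟨k * g2 * g1⁻¹ * k⁻¹, C, ?_, hC, ?_, fun a ha => hFC (hc ha)⟩
  · intro a ha
    have hac : a ∈ Fd c := hc ha
    have e1 : g1 a = k⁻¹ a := eqOn_Fd (f := g1.toMonoidHom) (g := (k⁻¹ : G).toMonoidHom) hg1 hac
    have e2 : g2 a = k⁻¹ (h a) :=
      eqOn_Fd (f := g2.toMonoidHom) (g := (k⁻¹ * h : G).toMonoidHom) hg2 hac
    simp only [mul_app]
    rw [← e1, inv_app, e2, app_inv]
  · rw [hCk]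
    intro w
    simp only [mul_app]
    rw [app_mem_img, hp2, hp1.inv]; rfl

lemma inv_update {n : ℕ} {x : ℕ → G} {z : G} {C : Subgroup F} :
    Inv (n + 1) (Function.update x n z) C ↔ Inv n x C ∧ Pres z C := by
  constructor
  · intro h
    refine ⟨⟨h.isC, fun i hi => ?_⟩, ?_⟩
    · have := h.pres i (by omega)
      rwa [Function.update_of_ne (by omega)] at this
    · have := h.pres n (by omega)
      rwa [Function.update_self] at this
  · rintro ⟨h, hz⟩
    refine ⟨h.isC, fun i hi => ?_⟩
    by_cases hin : i = n
    · subst hin; rwa [Function.update_self]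
    · rw [Function.update_of_ne hin]; exact h.pres i (by omega)

lemma DO1 {n : ℕ} {x : ℕ → G} (hx : Good n x) (A : Finset F) :
    DO {z | ∃ C, Inv (n + 1) (Function.update x n z) C ∧ ∀ a ∈ A, a ∈ C} := by
  classical
  intro h K
  obtain ⟨z, C, h1, h2, h3, h4⟩ := dense1 hx h (K ∪ A)
  obtain ⟨B, -, hB, -⟩ := h2.isC.gens
  refine ⟨z, fun a ha => h1 a (Finset.mem_union_left _ ha), B, fun k hk => ?_⟩
  exact ⟨C, inv_update.2 ⟨h2, h3.congr (hB _ _ hk)⟩, fun a ha => h4 a (Finset.mem_union_right _ ha)⟩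

/-- the extension condition -/
def Hyp (n : ℕ) (x : ℕ → G) (C C1 : Subgroup F) (y : ℕ → G) : Prop :=
  Inv n x C ∧ Inv n y C1 ∧ C ≤ C1 ∧ (∀ i < n, ∀ w ∈ C, y i w = x i w)

def Conc (n : ℕ) (x : ℕ → G) (C C1 : Subgroup F) (y : ℕ → G) : Prop :=
  ∃ f : G, (∀ w ∈ C, f w = w) ∧ ∀ i < n, ∀ w ∈ C1, f (y i w) = x i (f w)

lemma DO2 {n : ℕ} {x : ℕ → G} (hx : Good n x) (C C1 : Subgroup F) (y : ℕ → G) :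
    DO {z | Hyp (n + 1) (Function.update x n z) C C1 y →
      Conc (n + 1) (Function.update x n z) C C1 y} := by
  classical
  intro h K
  by_cases hC : IsC C
  swap
  · exact ⟨h, fun _ _ => rfl, ∅, fun k _ hk => absurd hk.1.isC hC⟩
  obtain ⟨B, hB1, hB2, hB3⟩ := hC.gens
  obtain ⟨h', C2, h1, h2, h3, h4⟩ := dense1 hx h (K ∪ B)
  by_cases hyp : Hyp (n + 1) (Function.update x n h') C C1 y
  swap
  · refine ⟨h', fun a ha => h1 a (Finset.mem_union_left _ ha), B, fun k hk hk2 => ?_⟩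
    exfalso
    apply hyp
    have hkC := hB2 _ _ hk
    obtain ⟨a1, a2, a3, a4⟩ := hk2
    rw [inv_update] at a1
    refine ⟨inv_update.2 ⟨a1.1, a1.2.congr (fun w hw => (hkC w hw).symm)⟩, a2, a3, ?_⟩
    intro i hi w hw
    rw [a4 i hi w hw]
    by_cases hin : i = n
    · subst hin; simp only [Function.update_self]; exact hkC w hw
    · simp only [Function.update_of_ne hin]
  obtain ⟨a1, a2, a3, a4⟩ := hyp
  have hCC2 : C ≤ C2 := hB3 C2 (fun a ha => h4 a (Finset.mem_union_right _ ha))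
  obtain ⟨f0, hf0, C3, b1, b2, z, b3, b4, b5⟩ := amalgam hC a2 (inv_update.2 ⟨h2, h3⟩) a3 hCC2 a1.pres
    (fun i hi w hw => (a4 i hi w hw).symm)
  obtain ⟨f1, c1, c2⟩ := hx.ext C2 C3 z h2 ⟨b3.isC, fun i hi => b3.pres i (by omega)⟩ b1 (by
    intro i hi w hw
    rw [b4 i (by omega) w hw, Function.update_of_ne (by omega)])
  have c1' : ∀ w ∈ C2, f1⁻¹ w = w := by
    intro w hw
    conv_lhs => rw [← c1 w hw]
    rw [inv_app]
  obtain ⟨B', -, hB', -⟩ := (a2.isC.cmap (f1 * f0)).gens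
  refine ⟨f1 * z n * f1⁻¹, ?_, B', ?_⟩
  · intro a ha
    have haC : a ∈ C2 := h4 a (Finset.mem_union_left _ ha)
    simp only [mul_app]
    rw [c1' a haC, b4 n (by omega) a haC, Function.update_self, c1 _ ((h3 a).2 haC),
      h1 a (Finset.mem_union_left _ ha)]
  · intro k hk _
    have hk' := hB' _ _ hk
    refine ⟨f1 * f0, ?_, ?_⟩
    · intro w hw
      rw [mul_app, hf0 w hw, c1 w (hCC2 hw)]
    · intro i hi w hw
      by_cases hin : i = n
      · subst hin
        rw [Function.update_self, hk' _ (app_mem_cmap.2 hw)]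
        simp only [mul_app]
        rw [inv_app, b5 i hi w hw]
      · simp only [Function.update_of_ne hin, mul_app]
        rw [← b5 i hi w hw, c2 i (by omega) _ (b2 w hw)]

/-- a countable dense set of automorphisms -/
lemma exists_dense : ∃ g0 : ℕ → G, ∀ (g : G) (A : Finset F), ∃ m, ∀ a ∈ A, g0 m a = g a := by
  classical
  obtain ⟨e, he⟩ := exists_surjective_nat (List F × List F)
  refine ⟨fun m => if h : ∃ g : G, (e m).1.map (fun a => g a) = (e m).2 then h.choose else 1, ?_⟩
  intro g A
  obtain ⟨m, hm⟩ := he (A.toList, A.toList.map (fun a => g a))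
  refine ⟨m, ?_⟩
  have hex : ∃ g : G, (e m).1.map (fun a => g a) = (e m).2 := ⟨g, by rw [hm]⟩
  have hs := hex.choose_spec
  generalize hk : hex.choose = k at hs
  simp only [hex, dite_true, hk]
  rw [hm] at hs
  intro a ha
  exact List.map_inj_left.1 hs a (Finset.mem_toList.2 ha)

theorem good_succ {n : ℕ} {x : ℕ → G} (hx : Good n x) : ∃ D : ℕ → Set G, (∀ m, DO (D m)) ∧
    ∀ z, (∀ m, z ∈ D m) → Good (n + 1) (Function.update x n z) := by
  classical
  obtain ⟨g0, hg0⟩ := exists_dense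
  obtain ⟨e1, he1⟩ := exists_surjective_nat (Finset F)
  obtain ⟨e2, he2⟩ := exists_surjective_nat ((ℕ × ℕ) × (ℕ × ℕ) × List ℕ)
  let cc : ℕ × ℕ → Subgroup F := fun p => img (g0 p.1) p.2
  let yy : List ℕ → ℕ → G := fun l i => g0 (l.getD i 0)
  have hcc : ∀ C, IsC C → ∃ p, cc p = C := by
    rintro C ⟨k, d, rfl⟩
    obtain ⟨m, hm⟩ := hg0 k ((Finset.range d).image FreeGroup.of)
    exact ⟨(m, d), img_congr (fun i hi => hm _ (Finset.mem_image_of_mem _ (Finset.mem_range.2 hi)))⟩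
  let D2 : ℕ → Set G := fun m =>
    {z | Hyp (n + 1) (Function.update x n z) (cc (e2 m).1) (cc (e2 m).2.1) (yy (e2 m).2.2) →
      Conc (n + 1) (Function.update x n z) (cc (e2 m).1) (cc (e2 m).2.1) (yy (e2 m).2.2)}
  let D1 : ℕ → Set G := fun m =>
    {z | ∃ C, Inv (n + 1) (Function.update x n z) C ∧ ∀ a ∈ e1 m, a ∈ C}
  refine ⟨fun m => if m % 2 = 0 then D1 (m / 2) else D2 (m / 2), ?_, ?_⟩
  · intro m
    by_cases hm : m % 2 = 0
    · simp only [hm, if_true]; exact DO1 hx _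
    · simp only [hm, if_false]; exact DO2 hx _ _ _
  · intro z hz
    have hz1 : ∀ m, z ∈ D1 m := by
      intro m
      have := hz (2 * m)
      beta_reduce at this
      rwa [if_pos (by omega), show 2 * m / 2 = m by omega] at this
    have hz2 : ∀ m, z ∈ D2 m := by
      intro m
      have := hz (2 * m + 1)
      beta_reduce at this
      rwa [if_neg (by omega), show (2 * m + 1) / 2 = m by omega] at this
    constructor
    · intro A
      obtain ⟨m, rfl⟩ := he1 A
      exact hz1 m
    · intro C C1 y h1 h2 h3 h4
      obtain ⟨p, hp⟩ := hcc C h1.isC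
      obtain ⟨p1, hp1⟩ := hcc C1 h2.isC
      obtain ⟨B, -, hB, -⟩ := h2.isC.gens
      choose L hL using fun i => hg0 (y i) B
      obtain ⟨m, hm⟩ := he2 (p, p1, (List.range (n + 1)).map L)
      have hyy : ∀ i < n + 1, ∀ w ∈ C1, yy ((List.range (n + 1)).map L) i w = y i w := by
        intro i hi
        have : yy ((List.range (n + 1)).map L) i = g0 (L i) := by
          simp [yy, List.getD, hi]
        rw [this]
        exact hB _ _ (hL i)
      have := hz2 m
      simp only [D2, hm, hp, hp1, Set.mem_ofPred_eq] at this
      obtain ⟨f, hf1, hf2⟩ := this ⟨h1, ⟨h2.isC, fun i hi => (h2.pres i hi).congr (hyy i hi)⟩, h3,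
        fun i hi w hw => by rw [hyy i hi w (h3 hw), h4 i hi w hw]⟩
      exact ⟨f, hf1, fun i hi w hw => by rw [← hf2 i hi w hw, hyy i hi w hw]⟩

end SIP


namespace SIP

section Main
variable {H : Subgroup G}

/-- An injective family of left cosets indexed by branches. -/
lemma no_big_family (hindex : Cardinal.mk (G ⧸ H) < 2 ^ Cardinal.aleph0)
    (φ : (ℕ → Bool) → G) : ∃ a b, a ≠ b ∧ (φ a)⁻¹ * φ b ∈ H := by
  by_contra! hcon
  have hinj : Function.Injective (fun a => (φ a : G ⧸ H)) := by
    intro a b hab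
    by_contra hne
    exact hcon a b hne (QuotientGroup.eq.1 hab)
  have h1 := Cardinal.mk_le_of_injective hinj
  have h2 : Cardinal.mk (ℕ → Bool) = 2 ^ Cardinal.aleph0 := by simp
  rw [h2] at h1
  exact absurd hindex (not_lt.2 h1)

lemma exists_good_mem (hindex : Cardinal.mk (G ⧸ H) < 2 ^ Cardinal.aleph0) {n : ℕ} {x : ℕ → G}
    (hx : Good n x) : ∃ x0 ∈ H, Good (n + 1) (Function.update x n x0) := by
  obtain ⟨D, hD, hD2⟩ := good_succ hx
  obtain ⟨φ, hφ⟩ := perfect D hD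
  obtain ⟨a, b, hab, hH⟩ := no_big_family hindex φ
  exact ⟨_, hH, hD2 _ (hφ a b hab)⟩

lemma tree_step (hindex : Cardinal.mk (G ⧸ H) < 2 ^ Cardinal.aleph0)
    (hH : ∀ A : Finset F, ∃ g : G, (∀ a ∈ A, g a = a) ∧ g ∉ H) (n : ℕ) (x : ℕ → G)
    (hx : Good n x) (A : Finset F) : ∃ x0 x1 f : G, x0 ∈ H ∧ x1 ∉ H ∧
      Good (n + 1) (Function.update x n x0) ∧ Good (n + 1) (Function.update x n x1) ∧
      (∀ a ∈ A, f a = a) ∧ (∀ i < n, f * x i = x i * f) ∧ f * x1 = x0 * f := by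
  obtain ⟨x0, h0, hg0⟩ := exists_good_mem hindex hx
  obtain ⟨C, hC, hAC⟩ := hg0.cof A
  obtain ⟨B, hB1, hB2, -⟩ := hC.isC.gens
  obtain ⟨g, hg, hgH⟩ := hH B
  have hgC : ∀ w ∈ C, g w = w := hB2 g 1 hg
  obtain ⟨D, hD, hD2⟩ := good_succ hx
  let D' : ℕ → Set G := fun m => if m % 2 = 0 then D (m / 2) else {z | z * g ∈ D (m / 2)}
  obtain ⟨y, hy, hyD⟩ := baire D' (fun m => by
    by_cases hm : m % 2 = 0
    · simp only [D', hm, if_true]; exact hD _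
    · simp only [D', hm, if_false]; exact (hD _).translate g) (x0, B)
  have hy1 : ∀ m, y ∈ D m := by
    intro m
    have := hyD (2 * m)
    simp only [D'] at this
    rwa [if_pos (by omega), show 2 * m / 2 = m by omega] at this
  have hy2 : ∀ m, y * g ∈ D m := by
    intro m
    have := hyD (2 * m + 1)
    simp only [D'] at this
    rwa [if_neg (by omega), show (2 * m + 1) / 2 = m by omega] at this
  have hyC : ∀ w ∈ C, y w = x0 w := hB2 y x0 hy
  have : ∃ x1 ∉ H, Good (n + 1) (Function.update x n x1) ∧ ∀ w ∈ C, x1 w = x0 w := by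
    by_cases hyH : y ∈ H
    · refine ⟨y * g, fun h => hgH ?_, hD2 _ hy2, fun w hw => ?_⟩
      · exact (H.mul_mem_cancel_left hyH).1 h
      · rw [mul_app, hgC w hw, hyC w hw]
    · exact ⟨y, hyH, hD2 _ hy1, hyC⟩
  obtain ⟨x1, hx1, hg1, hx1C⟩ := this
  rw [inv_update] at hC
  obtain ⟨f, hf1, hf2⟩ := homog hg0 hg1 (inv_update.2 ⟨hC.1, hC.2.congr hx1C⟩) (by
    intro i hi w hw
    by_cases hin : i = n
    · subst hin; simp only [Function.update_self]; exact hx1C w hw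
    · simp only [Function.update_of_ne hin])
  refine ⟨x0, x1, f, h0, hx1, hg0, hg1, fun a ha => hf1 a (hAC a ha), ?_, ?_⟩
  · intro i hi
    have := hf2 i (by omega)
    rwa [Function.update_of_ne (by omega), Function.update_of_ne (by omega)] at this
  · have := hf2 n (by omega)
    rwa [Function.update_self, Function.update_self] at this

theorem main (hindex : Cardinal.mk (G ⧸ H) < 2 ^ Cardinal.aleph0) :
    ∃ A : Finset F, ∀ g : G, (∀ a ∈ A, g a = a) → g ∈ H := by
  classical
  by_contra! hH
  obtain ⟨e, he⟩ := exists_surjective_nat F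
  have hst : ∀ n (x : ℕ → G) (A : Finset F), ∃ x0 x1 f : G, Good n x → (x0 ∈ H ∧ x1 ∉ H ∧
      Good (n + 1) (Function.update x n x0) ∧ Good (n + 1) (Function.update x n x1) ∧
      (∀ a ∈ A, f a = a) ∧ (∀ i < n, f * x i = x i * f) ∧ f * x1 = x0 * f) := by
    intro n x A
    by_cases hx : Good n x
    · obtain ⟨x0, x1, f, h⟩ := tree_step hindex hH n x hx A
      exact ⟨x0, x1, f, fun _ => h⟩
    · exact ⟨1, 1, 1, fun h => absurd h hx⟩
  choose X0 X1 ff hff using hst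
  let A' : ℕ → G × Finset F × (ℕ → G) → Finset F := fun n s => s.2.1 ∪ {e n, s.1⁻¹ (e n)}
  let child : ℕ → Bool → G × Finset F × (ℕ → G) → G × Finset F × (ℕ → G) := fun n t s =>
    if t then (s.1 * ff n s.2.2 (A' n s), A' n s, Function.update s.2.2 n (X1 n s.2.2 (A' n s)))
    else (s.1, A' n s, Function.update s.2.2 n (X0 n s.2.2 (A' n s)))
  let T : (ℕ → Bool) → ℕ → G × Finset F × (ℕ → G) := fun a n =>
    Nat.rec (1, ∅, fun _ => 1) (fun n s => child n (a n) s) n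
  have hT : ∀ a n, T a (n + 1) = child n (a n) (T a n) := fun a n => rfl
  have hgood : ∀ a n, Good n (T a n).2.2 := by
    intro a n
    induction n with
    | zero => exact good_zero _
    | succ n ih =>
      rw [hT]
      obtain ⟨-, -, h1, h2, -⟩ := hff n _ (A' n (T a n)) ih
      cases h : a n
      · simpa only [child, Bool.false_eq_true, if_false] using h1
      · simpa only [child, if_true] using h2
  have hA : ∀ a n, (T a (n + 1)).2.1 = A' n (T a n) := by
    intro a n
    rw [hT]
    cases h : a n <;> simp [child]
  have hAsub : ∀ a n, (T a n).2.1 ⊆ A' n (T a n) := fun a n => Finset.subset_union_left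
  have hstep : ∀ a n, ∃ f : G, (T a (n + 1)).1 = (T a n).1 * f ∧ (∀ w ∈ A' n (T a n), f w = w) ∧
      ∀ i < n, f * (T a n).2.2 i = (T a n).2.2 i * f := by
    intro a n
    rw [hT]
    obtain ⟨-, -, -, -, h3, h4, -⟩ := hff n _ (A' n (T a n)) (hgood a n)
    cases h : a n
    · exact ⟨1, by simp [child], fun _ _ => rfl, by simp⟩
    · exact ⟨_, by simp only [child, if_true], h3, h4⟩
  have hx : ∀ a n, ∀ i < n, (T a (n + 1)).2.2 i = (T a n).2.2 i := by
    intro a n i hi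
    rw [hT]
    cases h : a n <;> simp only [child, if_true, Bool.false_eq_true, if_false] <;>
      rw [Function.update_of_ne (by omega)]
  have hx' : ∀ a n m, n ≤ m → ∀ i < n, (T a m).2.2 i = (T a n).2.2 i := by
    intro a n m hnm
    induction m, hnm using Nat.le_induction with
    | base => intro i _; rfl
    | succ m hnm ih =>
      intro i hi
      rw [hx a m i (by omega), ih i hi]
  have htail : ∀ a n m, n ≤ m → ∀ i < n,
      ((T a n).1⁻¹ * (T a m).1) * (T a n).2.2 i = (T a n).2.2 i * ((T a n).1⁻¹ * (T a m).1) := by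
    intro a n m hnm i hi
    induction m, hnm using Nat.le_induction with
    | base => simp
    | succ m hnm ih =>
      obtain ⟨f, h1, -, h2⟩ := hstep a m
      have h3 := h2 i (by omega)
      rw [hx' a n m hnm i hi] at h3
      rw [h1, ← mul_assoc, mul_assoc _ f, h3, ← mul_assoc, ih, mul_assoc, mul_assoc]
  have hcovA : ∀ a w, ∃ n, w ∈ (T a n).2.1 := by
    intro a w
    obtain ⟨n, rfl⟩ := he w
    exact ⟨n + 1, by rw [hA]; simp [A']⟩
  have hlim : ∀ a, ∃ g : G, ∀ n, ∀ w ∈ (T a n).2.1, g w = (T a n).1 w := by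
    intro a
    have := fusion (fun n => (T a n).1) (fun n => ((T a n).2.1 : Set F)) (fun n => by
      rw [hA]; exact_mod_cast hAsub a n) (fun n w hw => by
      obtain ⟨f, h1, h2, -⟩ := hstep a n
      simp only [h1, mul_app]
      rw [h2 w (hAsub a n hw)]) (fun w => (hcovA a w).imp (fun n h => by exact_mod_cast h))
      (fun w => by
        obtain ⟨n, rfl⟩ := he w
        refine ⟨n + 1, ?_⟩
        obtain ⟨f, h1, h2, -⟩ := hstep a n
        have hm : (T a n).1⁻¹ (e n) ∈ A' n (T a n) := by simp [A']
        have h4 : (T a (n + 1)).1⁻¹ (e n) = (T a n).1⁻¹ (e n) := by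
          rw [h1, mul_inv_rev, mul_app]
          conv_lhs => rw [← h2 _ hm]
          rw [inv_app]
        simp only [h4, hA]
        exact_mod_cast hm)
    obtain ⟨g, hg⟩ := this
    exact ⟨g, fun n w hw => hg n w hw⟩
  choose lim hlim using hlim
  have hmono : ∀ a, Monotone (fun n => (T a n).2.1) := fun a =>
    monotone_nat_of_le_succ (fun n => by rw [hA]; exact hAsub a n)
  have hcomm : ∀ a n, ∀ i < n,
      ((T a n).1⁻¹ * lim a) * (T a n).2.2 i = (T a n).2.2 i * ((T a n).1⁻¹ * lim a) := by
    intro a n i hi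
    ext1 w
    obtain ⟨m1, h1⟩ := hcovA a w
    obtain ⟨m2, h2⟩ := hcovA a ((T a n).2.2 i w)
    let m := max n (max m1 m2)
    have h1' := hlim a m w (hmono a (by simp [m]) h1)
    have h2' := hlim a m _ (hmono a (by simp [m]) h2)
    have h3 := DFunLike.congr_fun (htail a n m (by simp [m]) i hi) w
    simp only [mul_app] at h3 ⊢
    rw [h1', h2', h3]
  have hTcongr : ∀ a b n, (∀ i < n, a i = b i) → T a n = T b n := by
    intro a b n
    induction n with
    | zero => intro _; rfl
    | succ n ih =>
      intro h
      rw [hT, hT, ih (fun i hi => h i (by omega)), h n (by omega)]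
  have hsep : ∀ a b n, (∀ i < n, a i = b i) → a n = false → b n = true →
      (lim a)⁻¹ * lim b ∉ H := by
    intro a b n hab han hbn hmem
    have hTn := hTcongr a b n hab
    obtain ⟨m0, m1, -, -, -, -, hf⟩ := hff n _ (A' n (T a n)) (hgood a n)
    have ea : T a (n + 1) = ((T a n).1, A' n (T a n),
      Function.update (T a n).2.2 n (X0 n (T a n).2.2 (A' n (T a n)))) := by
      rw [hT, han]; simp [child]
    have eb : T b (n + 1) = ((T a n).1 * ff n (T a n).2.2 (A' n (T a n)), A' n (T a n),
      Function.update (T a n).2.2 n (X1 n (T a n).2.2 (A' n (T a n)))) := by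
      rw [hT, hbn, ← hTn]; simp [child]
    have ca := hcomm a (n + 1) n (by omega)
    have cb := hcomm b (n + 1) n (by omega)
    rw [ea] at ca
    rw [eb] at cb
    simp only [Function.update_self] at ca cb
    generalize X0 n (T a n).2.2 (A' n (T a n)) = x0 at *
    generalize X1 n (T a n).2.2 (A' n (T a n)) = x1 at *
    generalize ff n (T a n).2.2 (A' n (T a n)) = f at *
    generalize (T a n).1 = h at *
    apply m1
    have hu : x1 = ((lim a)⁻¹ * lim b)⁻¹ * x0 * ((lim a)⁻¹ * lim b) := by
      have e1 : (lim a)⁻¹ * lim b = (h⁻¹ * lim a)⁻¹ * f * ((h * f)⁻¹ * lim b) := by group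
      rw [e1]
      generalize h⁻¹ * lim a = ta at *
      generalize (h * f)⁻¹ * lim b = tb at *
      have : (ta⁻¹ * f * tb) * x1 = x0 * (ta⁻¹ * f * tb) := by
        have c3 : ta⁻¹ * x0 = x0 * ta⁻¹ := by
          rw [inv_mul_eq_iff_eq_mul, ← mul_assoc, ca, mul_inv_cancel_right]
        rw [mul_assoc, cb, ← mul_assoc, mul_assoc ta⁻¹, hf, ← mul_assoc ta⁻¹, c3]
        simp only [mul_assoc]
      rw [mul_assoc, ← this, inv_mul_cancel_left]
    rw [hu]
    exact H.mul_mem (H.mul_mem (H.inv_mem hmem) m0) hmem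
  obtain ⟨a, b, hab, hmem⟩ := no_big_family hindex lim
  have hex : ∃ n, a n ≠ b n := Function.ne_iff.1 hab
  have hn := Nat.find_spec hex
  have hlt : ∀ i < Nat.find hex, a i = b i := fun i hi => not_not.1 (Nat.find_min hex hi)
  generalize Nat.find hex = n at hn hlt
  cases ha : a n <;> cases hb : b n
  · exact hn (by rw [ha, hb])
  · exact hsep a b n hlt ha hb hmem
  · refine hsep b a n (fun i hi => (hlt i hi).symm) hb ha ?_
    have := H.inv_mem hmem
    rwa [mul_inv_rev, inv_inv] at this
  · exact hn (by rw [ha, hb])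

end Main

end SIP

/-- Small index property for the free group on `ω` generators (Bryant–Evans):
any subgroup of `Aut(F)` of index `< 2^ℵ₀` contains the pointwise stabilizer of a
finite subset of `F`. -/
theorem smallIndexProperty_autFreeGroup (H : Subgroup (MulAut (FreeGroup ℕ)))
    (hindex : Cardinal.mk (MulAut (FreeGroup ℕ) ⧸ H) < 2 ^ Cardinal.aleph0) :
    ∃ A : Set (FreeGroup ℕ), A.Finite ∧
      ∀ g : MulAut (FreeGroup ℕ), (∀ a ∈ A, g a = a) → g ∈ H := by
  obtain ⟨A, hA⟩ := SIP.main hindex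
  exact ⟨A, A.finite_toSet, fun g hg => hA g fun a ha => hg a ha⟩
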